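/- arXiv:1208.6286 — 4 statements merged into one kernel-verified Lean document; each statement's English description precedes it below -/
import Mathlib

section
/- Let c ∈ ℭ_+(N). Then for each P ∈ 𝔓_+(N) there exists a unique Q ∈ 𝔓_+(N) such that the function Φ defined by Φ(ζ_j) := P(ζ_j)/Q(ζ_j) satisfies the moment conditions for c. -/
open Complex Finset Filter Topology

noncomputable section

/-- Coefficient space for symmetric trigonometric polynomials of degree `n`:
`(p₀, (p₁, …, pₙ))` with `p₀` real and `p₋ₖ = conj pₖ` implicit. Also used for
covariance data `c = (c₀, (c₁, …, cₙ))`. -/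
abbrev Coef (n : ℕ) := ℝ × (Fin n → ℂ)

/-- The `2N`-th roots of unity `ζ_j = exp(iπj/N)`. -/
def zet (N : ℕ) (j : ℤ) : ℂ := Complex.exp (Real.pi * Complex.I * j / N)

/-- The index set `j = -N+1, …, N`. -/
def idxs (N : ℕ) : Finset ℤ := Finset.Icc (-(N : ℤ) + 1) N

/-- Evaluation of `P(z) = Σ_{k=-n}^n p_k z^{-k}` (with `p₋ₖ = conj pₖ`). -/
def evalC {n : ℕ} (p : Coef n) (z : ℂ) : ℂ :=
  (p.1 : ℂ) + ∑ k : Fin n,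
    (p.2 k * z⁻¹ ^ ((k : ℕ) + 1) + (starRingEnd ℂ) (p.2 k) * z ^ ((k : ℕ) + 1))

/-- Real value of the symmetric trigonometric polynomial on the unit circle. -/
def evalR {n : ℕ} (p : Coef n) (z : ℂ) : ℝ := (evalC p z).re

/-- The open cone `𝔓₊(N)`. -/
def Pplus (n N : ℕ) : Set (Coef n) := {p | ∀ j ∈ idxs N, 0 < evalR p (zet N j)}

/-- The closure of `𝔓₊(N)`: `P(ζ_j) ≥ 0` for all `j`. -/
def Pnn (n N : ℕ) : Set (Coef n) := {p | ∀ j ∈ idxs N, 0 ≤ evalR p (zet N j)}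

/-- The cone `𝔓₊` of trigonometric polynomials positive on the whole circle. -/
def PplusC (n : ℕ) : Set (Coef n) :=
  {p | ∀ θ ∈ Set.Icc (-Real.pi) Real.pi, 0 < evalR p (Complex.exp (θ * Complex.I))}

/-- The closure of `𝔓₊`: nonnegative on the whole circle. -/
def PnnC (n : ℕ) : Set (Coef n) :=
  {p | ∀ θ ∈ Set.Icc (-Real.pi) Real.pi, 0 ≤ evalR p (Complex.exp (θ * Complex.I))}

/-- The pairing `⟨C,P⟩ = Σ_{k=-n}^n c_k conj(p_k)` (a real number). -/
def pairCP {n : ℕ} (c p : Coef n) : ℝ :=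
  c.1 * p.1 + ∑ k : Fin n, 2 * (c.2 k * (starRingEnd ℂ) (p.2 k)).re

/-- The open dual cone `ℭ₊(N)`. -/
def Cplus (n N : ℕ) : Set (Coef n) := {c | ∀ p ∈ Pnn n N, p ≠ 0 → 0 < pairCP c p}

/-- The open dual cone `ℭ₊`. -/
def CplusC (n : ℕ) : Set (Coef n) := {c | ∀ p ∈ PnnC n, p ≠ 0 → 0 < pairCP c p}

/-- The discrete moment `(1/(2N)) Σ_j ζ_j^k Φ(ζ_j)`. -/
def dmom (N : ℕ) (Φ : ℤ → ℝ) (k : ℤ) : ℂ :=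
  (1 / (2 * (N : ℂ))) * ∑ j ∈ idxs N, zet N j ^ k * (Φ j : ℂ)

/-- `Φ` (a function of the index `j`) satisfies the moment conditions for `c`. -/
def MomCond {n : ℕ} (N : ℕ) (c : Coef n) (Φ : ℤ → ℝ) : Prop :=
  dmom N Φ 0 = (c.1 : ℂ) ∧ ∀ k : Fin n, dmom N Φ ((k : ℕ) + 1) = c.2 k

/-- The function `j ↦ P(ζ_j)/Q(ζ_j)`. -/
def phiOf {n : ℕ} (N : ℕ) (P Q : Coef n) : ℤ → ℝ :=
  fun j => evalR P (zet N j) / evalR Q (zet N j)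

/-- The dual functional `J_P(Q) = ⟨C,Q⟩ − (1/(2N)) Σ_j P(ζ_j) log Q(ζ_j)`. -/
def JP {n : ℕ} (N : ℕ) (c P Q : Coef n) : ℝ :=
  pairCP c Q - (1 / (2 * (N : ℝ))) * ∑ j ∈ idxs N,
    evalR P (zet N j) * Real.log (evalR Q (zet N j))

/-- The moment map `F^P`, with components `F^P_k(Q) = (1/(2N)) Σ_j ζ_j^k P(ζ_j)/Q(ζ_j)`. -/
def Fmap {n : ℕ} (N : ℕ) (P Q : Coef n) : Coef n :=
  ((dmom N (phiOf N P Q) 0).re, fun k => dmom N (phiOf N P Q) ((k : ℕ) + 1))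

section WeightedLogBarrier

variable {V ι : Type*} [NormedAddCommGroup V] [NormedSpace ℝ V]

/-- A linear functional that is positive on the nonzero elements of a polyhedral cone has compact
slices in that cone. -/
lemma isCompact_cone_slice [FiniteDimensional ℝ V] (s : Finset ι) (L : ι → V →L[ℝ] ℝ) (l : V →L[ℝ] ℝ)
    (hl : ∀ v, (∀ j ∈ s, 0 ≤ L j v) → v ≠ 0 → 0 < l v) :
    IsCompact {v : V | (∀ j ∈ s, 0 ≤ L j v) ∧ l v = 1} := by
  have : ProperSpace V := FiniteDimensional.proper ℝ V
  have hcone : IsClosed {v : V | ∀ j ∈ s, 0 ≤ L j v} := by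
    simp only [Set.ofPred_forall]
    exact isClosed_iInter fun j => isClosed_iInter fun _ =>
      isClosed_le continuous_const (L j).continuous
  have hclosed : IsClosed {v : V | (∀ j ∈ s, 0 ≤ L j v) ∧ l v = 1} :=
    hcone.inter (isClosed_eq l.continuous continuous_const)
  obtain ⟨ε, hε, hεl⟩ : ∃ ε > 0, ∀ v ∈ Metric.sphere (0 : V) 1 ∩ {v | ∀ j ∈ s, 0 ≤ L j v},
      ε ≤ l v := by
    have hK := (isCompact_sphere (0 : V) 1).inter_right hcone
    rcases Set.eq_empty_or_nonempty
      (Metric.sphere (0 : V) 1 ∩ {v | ∀ j ∈ s, 0 ≤ L j v}) with h | h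
    · exact ⟨1, one_pos, by simp [h]⟩
    · obtain ⟨x, hx, hmin⟩ := hK.exists_isMinOn h l.continuous.continuousOn
      exact ⟨l x, hl x hx.2 (ne_zero_of_mem_unit_sphere (⟨x, hx.1⟩ : Metric.sphere (0 : V) 1)),
        fun v hv => hmin hv⟩
  refine Metric.isCompact_of_isClosed_isBounded hclosed
    ((Metric.isBounded_closedBall (x := (0 : V)) (r := ε⁻¹)).subset ?_)
  rintro v ⟨hv, hv1⟩
  rw [mem_closedBall_zero_iff]
  have hv0 : v ≠ 0 := by rintro rfl; simp at hv1
  have hn : 0 < ‖v‖ := norm_pos_iff.mpr hv0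
  have h := hεl (‖v‖⁻¹ • v) ⟨by simp [norm_smul, hn.ne'], fun j hj => by
    simpa using mul_nonneg (inv_nonneg.mpr hn.le) (hv j hj)⟩
  rw [map_smul, hv1, smul_eq_mul, mul_one] at h
  exact (le_inv_comm₀ hε hn).mp h

/-- A functional that is positive on the cone `{v | ∀ j ∈ s, 0 ≤ L j v}` minus the origin is the
weighted logarithmic gradient of the functionals `L j` at some interior point of the cone. -/
lemma exists_log_gradient_eq [FiniteDimensional ℝ V] (s : Finset ι) (hs : s.Nonempty) (L : ι → V →L[ℝ] ℝ)
    (l : V →L[ℝ] ℝ) (hl : ∀ v, (∀ j ∈ s, 0 ≤ L j v) → v ≠ 0 → 0 < l v)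
    (w : ι → ℝ) (hw : ∀ j ∈ s, 0 < w j) (v₀ : V) (hv₀ : ∀ j ∈ s, 0 < L j v₀) :
    ∃ q : V, (∀ j ∈ s, 0 < L j q) ∧ ∀ v, ∑ j ∈ s, w j / L j q * L j v = l v := by
  set K : Set V := {v : V | (∀ j ∈ s, 0 ≤ L j v) ∧ l v = 1}
  have hne : v₀ ≠ 0 := by
    rintro rfl
    obtain ⟨j, hj⟩ := hs
    simpa using hv₀ j hj
  have hlv₀ : 0 < l v₀ := hl v₀ (fun j hj => (hv₀ j hj).le) hne
  have hpos₁ : ∀ j ∈ s, 0 < L j ((l v₀)⁻¹ • v₀) := fun j hj => by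
    simpa using mul_pos (inv_pos.mpr hlv₀) (hv₀ j hj)
  have hmem₁ : (l v₀)⁻¹ • v₀ ∈ K :=
    ⟨fun j hj => (hpos₁ j hj).le, by simp [hlv₀.ne']⟩
  have hG : ContinuousOn (fun v => ∏ j ∈ s, (L j v) ^ (w j)) K :=
    continuousOn_finsetProd s fun j hj =>
      (L j).continuous.continuousOn.rpow_const fun _ _ => Or.inr (hw j hj).le
  obtain ⟨q, ⟨hq0, hq1⟩, hmax⟩ :=
    (isCompact_cone_slice s L l hl).exists_isMaxOn ⟨_, hmem₁⟩ hG
  have hGq : 0 < ∏ j ∈ s, (L j q) ^ (w j) :=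
    (Finset.prod_pos fun j hj => Real.rpow_pos_of_pos (hpos₁ j hj) (w j)).trans_le (hmax hmem₁)
  have hq : ∀ j ∈ s, 0 < L j q := fun j hj => by
    refine (hq0 j hj).lt_of_ne fun h => (Finset.prod_ne_zero_iff.mp hGq.ne' j hj) ?_
    rw [← h, Real.zero_rpow (hw j hj).ne']
  have hcrit : ∀ v, l v = 0 → ∑ j ∈ s, w j / L j q * L j v = 0 := by
    intro v hv
    have hderiv : HasDerivAt (fun t : ℝ => ∑ j ∈ s, w j * Real.log (L j q + t * L j v))
        (∑ j ∈ s, w j / L j q * L j v) 0 := by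
      refine HasDerivAt.fun_sum fun j hj => ?_
      have h1 : HasDerivAt (fun t : ℝ => L j q + t * L j v) (L j v) 0 := by
        simpa using ((hasDerivAt_id (0 : ℝ)).mul_const (L j v)).const_add (L j q)
      simpa [mul_div_assoc, div_mul_eq_mul_div] using
        (h1.log (by simpa using (hq j hj).ne')).const_mul (w j)
    refine IsLocalMax.hasDerivAt_eq_zero ?_ hderiv
    have hev : ∀ᶠ t : ℝ in 𝓝 0, ∀ j ∈ s, 0 < L j q + t * L j v := by
      refine (Finset.eventually_all s).mpr fun j hj => ?_
      have hc : ContinuousAt (fun t : ℝ => L j q + t * L j v) 0 := by fun_prop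
      exact hc.eventually (lt_mem_nhds (by simpa using hq j hj))
    filter_upwards [hev] with t ht
    have hlog : ∀ u : V, (∀ j ∈ s, 0 < L j u) →
        Real.log (∏ j ∈ s, (L j u) ^ (w j)) = ∑ j ∈ s, w j * Real.log (L j u) := fun u hu => by
      rw [Real.log_prod fun j hj => (Real.rpow_pos_of_pos (hu j hj) _).ne']
      exact Finset.sum_congr rfl fun j hj => Real.log_rpow (hu j hj) _
    have hpt : ∀ j ∈ s, 0 < L j (q + t • v) := fun j hj => by simpa using ht j hj
    have hle := Real.log_le_log
      (Finset.prod_pos fun j hj => Real.rpow_pos_of_pos (hpt j hj) (w j))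
      (hmax (show q + t • v ∈ K from ⟨fun j hj => (hpt j hj).le, by simp [hq1, hv]⟩))
    rw [hlog _ hpt, hlog _ hq] at hle
    simpa using hle
  have hW : 0 < ∑ j ∈ s, w j := Finset.sum_pos hw hs
  refine ⟨(∑ j ∈ s, w j) • q, fun j hj => by simpa using mul_pos hW (hq j hj), fun v => ?_⟩
  have h := hcrit (v - l v • q) (by simp [hq1])
  have hexp : ∑ j ∈ s, w j / L j q * L j (v - l v • q) =
      ∑ j ∈ s, w j / L j q * L j v - l v * ∑ j ∈ s, w j := by
    rw [Finset.mul_sum, ← Finset.sum_sub_distrib]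
    refine Finset.sum_congr rfl fun j hj => ?_
    have := (hq j hj).ne'
    simp only [map_sub, map_smul, smul_eq_mul]
    field_simp
  have hscale : ∑ j ∈ s, w j / L j ((∑ j ∈ s, w j) • q) * L j v =
      (∑ j ∈ s, w j)⁻¹ * ∑ j ∈ s, w j / L j q * L j v := by
    rw [Finset.mul_sum]
    refine Finset.sum_congr rfl fun j hj => ?_
    rw [map_smul, smul_eq_mul, div_mul_eq_div_div_swap]
    ring
  rw [hscale, sub_eq_zero.mp (hexp.symm.trans h)]
  field_simp

/-- The weighted logarithmic gradient separates points up to the common kernel. -/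
lemma eq_on_of_log_gradient_eq (s : Finset ι) (L : ι → V →L[ℝ] ℝ)
    (w : ι → ℝ) (hw : ∀ j ∈ s, 0 < w j) (p q : V) (hp : ∀ j ∈ s, 0 < L j p)
    (hq : ∀ j ∈ s, 0 < L j q)
    (h : ∀ v, ∑ j ∈ s, w j / L j p * L j v = ∑ j ∈ s, w j / L j q * L j v) :
    ∀ j ∈ s, L j p = L j q := by
  have hsum : ∑ j ∈ s, w j * (L j p - L j q) ^ 2 / (L j p * L j q) = 0 := by
    rw [← sub_eq_zero.mpr (h (q - p)), ← Finset.sum_sub_distrib]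
    refine Finset.sum_congr rfl fun j hj => ?_
    have := (hp j hj).ne'
    have := (hq j hj).ne'
    rw [map_sub]
    field_simp
    ring
  intro j hj
  have hterm := (Finset.sum_eq_zero_iff_of_nonneg fun i hi =>
    div_nonneg (mul_nonneg (hw i hi).le (sq_nonneg (L i p - L i q)))
      (mul_pos (hp i hi) (hq i hi)).le).mp hsum j hj
  have hne := (mul_pos (hp j hj) (hq j hj)).ne'
  rw [div_eq_zero_iff, or_iff_left hne, mul_eq_zero, or_iff_right (hw j hj).ne',
    sq_eq_zero_iff, sub_eq_zero] at hterm
  exact hterm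

end WeightedLogBarrier

/-- The pairing `⟨C,·⟩` as a continuous linear functional. -/
def pairCLM {n : ℕ} (c : Coef n) : Coef n →L[ℝ] ℝ :=
  LinearMap.toContinuousLinearMap
    { toFun := pairCP c
      map_add' := fun p q => by
        simp only [pairCP, Prod.fst_add, Prod.snd_add, Pi.add_apply, map_add, mul_add,
          Complex.add_re, Finset.sum_add_distrib]
        ring
      map_smul' := fun a p => by
        simp only [pairCP, Prod.smul_fst, Prod.smul_snd, Pi.smul_apply, smul_eq_mul,
          RingHom.id_apply, mul_add, Finset.mul_sum, Complex.mul_re, Complex.conj_re,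
          Complex.conj_im, Complex.smul_re, Complex.smul_im]
        congr 1
        · ring
        · exact Finset.sum_congr rfl fun k _ => by ring }

@[simp]
lemma pairCLM_apply {n : ℕ} (c p : Coef n) : pairCLM c p = pairCP c p := rfl

lemma pairCP_left_injective {n : ℕ} {c d : Coef n} (h : ∀ p, pairCP c p = pairCP d p) :
    c = d := by
  refine Prod.ext (by simpa [pairCP] using h (1, 0)) (funext fun k => ?_)
  have key : ∀ (e : Coef n) (z : ℂ),
      pairCP e (0, Pi.single k z) = 2 * (e.2 k * (starRingEnd ℂ) z).re := by
    intro e z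
    simp only [pairCP, mul_zero, zero_add]
    rw [Finset.sum_eq_single k (fun i _ hi => by simp [hi]) (by simp)]
    simp
  have h1 := h (0, Pi.single k 1)
  have h2 := h (0, Pi.single k Complex.I)
  rw [key, key] at h1 h2
  apply Complex.ext
  · simpa using h1
  · simpa using h2

lemma norm_zet (N : ℕ) (j : ℤ) : ‖zet N j‖ = 1 := by
  have h : (Real.pi * Complex.I * j / N : ℂ) = ((Real.pi * j / N : ℝ) : ℂ) * Complex.I := by
    push_cast
    ring
  rw [zet, h, Complex.norm_exp_ofReal_mul_I]

/-- Evaluation at a point of the unit circle is a pairing with the moment vector. -/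
lemma evalR_eq_pairCP {n : ℕ} (p : Coef n) {z : ℂ} (hz : ‖z‖ = 1) :
    evalR p z = pairCP (1, fun k : Fin n => z ^ ((k : ℕ) + 1)) p := by
  simp only [evalR, evalC, pairCP, Complex.add_re, Complex.ofReal_re, Complex.re_sum, one_mul]
  congr 1
  refine Finset.sum_congr rfl fun k _ => ?_
  rw [Complex.inv_eq_conj hz, ← map_pow]
  simp only [Complex.mul_re, Complex.conj_re, Complex.conj_im]
  ring

/-- The discrete moments of a real function, as covariance data. -/
def momentCoef (n N : ℕ) (Φ : ℤ → ℝ) : Coef n :=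
  ((dmom N Φ 0).re, fun k => dmom N Φ ((k : ℕ) + 1))

lemma dmom_zero_im (N : ℕ) (Φ : ℤ → ℝ) : (dmom N Φ 0).im = 0 := by
  have h : dmom N Φ 0 = ((1 / (2 * (N : ℝ)) * ∑ j ∈ idxs N, Φ j : ℝ) : ℂ) := by
    simp [dmom]
  rw [h, Complex.ofReal_im]

lemma momCond_iff {n : ℕ} (N : ℕ) (c : Coef n) (Φ : ℤ → ℝ) :
    MomCond N c Φ ↔ momentCoef n N Φ = c := by
  rw [MomCond, momentCoef, Prod.ext_iff, funext_iff, Complex.ext_iff]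
  simp [dmom_zero_im]

lemma pairCP_momentCoef {n : ℕ} (N : ℕ) (Φ : ℤ → ℝ) (p : Coef n) :
    pairCP (momentCoef n N Φ) p =
      ∑ j ∈ idxs N, 1 / (2 * (N : ℝ)) * Φ j * evalR p (zet N j) := by
  have hre : ∀ (k : ℤ) (u : ℂ), (dmom N Φ k * u).re =
      ∑ j ∈ idxs N, 1 / (2 * (N : ℝ)) * Φ j * (zet N j ^ k * u).re := by
    intro k u
    rw [dmom, Finset.mul_sum, Finset.sum_mul, Complex.re_sum]
    refine Finset.sum_congr rfl fun j _ => ?_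
    rw [← Complex.re_ofReal_mul]
    push_cast
    ring_nf
  have hre0 : (dmom N Φ 0).re = ∑ j ∈ idxs N, 1 / (2 * (N : ℝ)) * Φ j := by
    simpa using hre 0 1
  simp only [evalR_eq_pairCP p (norm_zet N _), pairCP, momentCoef, hre, hre0, mul_add,
    Finset.sum_add_distrib, Finset.sum_mul, Finset.mul_sum, one_mul]
  congr 1
  rw [Finset.sum_comm]
  refine Finset.sum_congr rfl fun j _ => Finset.sum_congr rfl fun k _ => ?_
  rw [← Nat.cast_succ, zpow_natCast]
  ring

/-- For `c ∈ ℭ₊(N)` and each `P ∈ 𝔓₊(N)` there is a unique `Q ∈ 𝔓₊(N)`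
such that `Φ(ζ_j) = P(ζ_j)/Q(ζ_j)` satisfies the moment conditions for `c`. -/
theorem circulant_rce_existence_uniqueness
    (n N : ℕ) (hn : 1 ≤ n) (hnN : n < N)
    (c : Coef n) (hc : c ∈ Cplus n N) (P : Coef n) (hP : P ∈ Pplus n N) :
    ∃! Q : Coef n, Q ∈ Pplus n N ∧ MomCond N c (phiOf N P Q) := by
  have hN : (0 : ℝ) < N := by exact_mod_cast (by omega : 0 < N)
  let L : ℤ → Coef n →L[ℝ] ℝ := fun j => pairCLM (1, fun k : Fin n => zet N j ^ ((k : ℕ) + 1))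
  have hL : ∀ j p, evalR p (zet N j) = L j p := fun j p => evalR_eq_pairCP p (norm_zet N j)
  let w : ℤ → ℝ := fun j => 1 / (2 * (N : ℝ)) * evalR P (zet N j)
  have hw : ∀ j ∈ idxs N, 0 < w j := fun j hj => mul_pos (by positivity) (hP j hj)
  have hmom : ∀ Q : Coef n, MomCond N c (phiOf N P Q) ↔
      ∀ v, ∑ j ∈ idxs N, w j / L j Q * L j v = pairCP c v := by
    intro Q
    have hsum : ∀ v, pairCP (momentCoef n N (phiOf N P Q)) v =
        ∑ j ∈ idxs N, w j / L j Q * L j v := fun v => by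
      rw [pairCP_momentCoef]
      refine Finset.sum_congr rfl fun j _ => ?_
      rw [phiOf, hL j Q, hL j v, mul_div_assoc]
    rw [momCond_iff]
    refine ⟨fun h v => by rw [← hsum, h], fun h => pairCP_left_injective fun v => ?_⟩
    rw [hsum, h]
  have hcL : ∀ v, (∀ j ∈ idxs N, 0 ≤ L j v) → v ≠ 0 → 0 < pairCLM c v := fun v hv hv0 =>
    hc v (fun j hj => (hL j v).symm ▸ hv j hj) hv0
  have hne : (idxs N).Nonempty := ⟨0, by simp only [idxs, Finset.mem_Icc]; omega⟩
  obtain ⟨Q, hQ, hQc⟩ := exists_log_gradient_eq (idxs N) hne L (pairCLM c) hcL w hw P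
    fun j hj => (hL j P) ▸ hP j hj
  refine ⟨Q, ⟨fun j hj => (hL j Q).symm ▸ hQ j hj, (hmom Q).mpr hQc⟩, ?_⟩
  rintro R ⟨hR, hRc⟩
  have heq := eq_on_of_log_gradient_eq (idxs N) L w hw R Q
    (fun j hj => (hL j R) ▸ hR j hj) hQ fun v => ((hmom R).mp hRc v).trans (hQc v).symm
  by_contra hRQ
  have h1 := hcL (R - Q) (fun j hj => by simp [heq j hj]) (sub_ne_zero.mpr hRQ)
  have h2 := hcL (Q - R) (fun j hj => by simp [heq j hj]) (sub_ne_zero.mpr (Ne.symm hRQ))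
  rw [map_sub] at h1 h2
  linarith
end
end

section
/- For every c = (c_0, c_1, …, c_n) and every P ∈ 𝔓_+(N), the functional J_P is strictly convex on the open convex cone 𝔓_+(N); that is, for all Q_1, Q_2 ∈ 𝔓_+(N) with Q_1 ≠ Q_2 and all t ∈ (0,1), J_P(tQ_1 + (1−t)Q_2) < t·J_P(Q_1) + (1−t)·J_P(Q_2). -/
open Complex Finset Filter Topology

noncomputable section

/-- The points `ζ_j` lie on the unit circle. -/
lemma conj_zet (N : ℕ) (j : ℤ) : (starRingEnd ℂ) (zet N j) = (zet N j)⁻¹ := by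
  rw [zet, ← Complex.exp_conj, ← Complex.exp_neg]
  simp [neg_div]

lemma zet_ne_zero (N : ℕ) (j : ℤ) : zet N j ≠ 0 := Complex.exp_ne_zero _

lemma zet_injOn {N : ℕ} (hN : 0 < N) : Set.InjOn (zet N) (idxs N) := by
  intro i hi j hj h
  obtain ⟨m, hm⟩ := Complex.exp_eq_exp_iff_exists_int.mp h
  have hN' : (N : ℂ) ≠ 0 := by exact_mod_cast hN.ne'
  have hpi : (Real.pi : ℂ) * Complex.I ≠ 0 :=
    mul_ne_zero (by exact_mod_cast Real.pi_ne_zero) Complex.I_ne_zero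
  have hij : (i : ℂ) = j + 2 * N * m := by
    field_simp at hm
    refine mul_left_cancel₀ hpi ?_
    linear_combination (Real.pi : ℂ) * Complex.I * hm
  have hij' : i = j + 2 * N * m := by exact_mod_cast hij
  simp only [idxs, coe_Icc, Set.mem_Icc] at hi hj
  have h1 : m < 1 := by nlinarith
  have h2 : -1 < m := by nlinarith
  have h3 : m = 0 := by omega
  simpa [h3] using hij'

lemma card_idxs (N : ℕ) : (idxs N).card = 2 * N := by
  rw [idxs, Int.card_Icc]
  omega

lemma evalC_zet_im {n : ℕ} (p : Coef n) (N : ℕ) (j : ℤ) : (evalC p (zet N j)).im = 0 := by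
  rw [← Complex.conj_eq_iff_im]
  simp only [evalC, map_add, map_sum, map_mul, map_pow, map_inv₀, conj_zet, inv_inv,
    Complex.conj_ofReal, Complex.conj_conj]
  congr 1
  exact Finset.sum_congr rfl fun k _ => add_comm _ _

/-- The algebraic polynomial `z ^ n * P(z)`. -/
def shiftPoly {n : ℕ} (p : Coef n) : Polynomial ℂ :=
  Polynomial.C (p.1 : ℂ) * Polynomial.X ^ n + ∑ k : Fin n,
    (Polynomial.C (p.2 k) * Polynomial.X ^ (n - (k + 1)) +
      Polynomial.C ((starRingEnd ℂ) (p.2 k)) * Polynomial.X ^ (n + (k + 1)))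

lemma eval_shiftPoly {n : ℕ} (p : Coef n) {z : ℂ} (hz : z ≠ 0) :
    (shiftPoly p).eval z = z ^ n * evalC p z := by
  simp only [shiftPoly, evalC, Polynomial.eval_add, Polynomial.eval_mul, Polynomial.eval_C,
    Polynomial.eval_pow, Polynomial.eval_X, Polynomial.eval_finsetSum, mul_add, Finset.mul_sum]
  congr 1
  · ring
  · refine Finset.sum_congr rfl fun k _ => ?_
    rw [pow_sub₀ z hz k.isLt, pow_add, inv_pow, Nat.succ_eq_add_one]
    ring

lemma natDegree_shiftPoly_le {n : ℕ} (p : Coef n) : (shiftPoly p).natDegree ≤ 2 * n := by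
  refine Polynomial.natDegree_add_le_of_degree_le
    ((Polynomial.natDegree_C_mul_X_pow_le _ _).trans (by omega))
    (Polynomial.natDegree_sum_le_of_forall_le _ _ fun k _ => ?_)
  exact Polynomial.natDegree_add_le_of_degree_le
    ((Polynomial.natDegree_C_mul_X_pow_le _ _).trans (by omega))
    ((Polynomial.natDegree_C_mul_X_pow_le _ _).trans (by omega))

lemma coeff_shiftPoly_self {n : ℕ} (p : Coef n) : (shiftPoly p).coeff n = p.1 := by
  simp only [shiftPoly, Polynomial.coeff_add, Polynomial.coeff_C_mul_X_pow,
    Polynomial.finsetSum_coeff, if_true]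
  rw [Finset.sum_eq_zero, add_zero]
  intro k _
  rw [if_neg (by omega), if_neg (by omega), add_zero]

lemma coeff_shiftPoly_add {n : ℕ} (p : Coef n) (k : Fin n) :
    (shiftPoly p).coeff (n + (k + 1)) = (starRingEnd ℂ) (p.2 k) := by
  simp only [shiftPoly, Polynomial.coeff_add, Polynomial.coeff_C_mul_X_pow,
    Polynomial.finsetSum_coeff]
  rw [if_neg (by omega), zero_add, Finset.sum_eq_single k]
  · rw [if_neg (by omega), if_pos rfl, zero_add]
  · intro l _ hl
    have : (l : ℕ) ≠ k := fun h => hl (Fin.ext h)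
    rw [if_neg (by omega), if_neg (by omega), add_zero]
  · simp

/-- A trigonometric polynomial of degree `n < N` vanishing at the `2N`-th roots of unity is zero. -/
lemma eq_zero_of_evalR_zet_eq_zero {n N : ℕ} (hnN : n < N) (p : Coef n)
    (h : ∀ j ∈ idxs N, evalR p (zet N j) = 0) : p = 0 := by
  have hp : shiftPoly p = 0 := by
    refine Polynomial.eq_zero_of_natDegree_lt_card_of_eval_eq_zero' _ ((idxs N).image (zet N))
      ?_ ?_
    · intro z hz
      obtain ⟨j, hj, rfl⟩ := Finset.mem_image.mp hz
      rw [eval_shiftPoly p (zet_ne_zero N j),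
        show evalC p (zet N j) = 0 from Complex.ext (h j hj) (evalC_zet_im p N j), mul_zero]
    · rw [Finset.card_image_of_injOn (zet_injOn (by omega)), card_idxs]
      exact (natDegree_shiftPoly_le p).trans_lt (by omega)
  refine Prod.ext ?_ (funext fun k => ?_)
  · simpa [hp] using (coeff_shiftPoly_self p).symm
  · simpa [hp] using (coeff_shiftPoly_add p k).symm

lemma evalR_add {n : ℕ} (p q : Coef n) (z : ℂ) : evalR (p + q) z = evalR p z + evalR q z := by
  rw [evalR, evalR, evalR, ← Complex.add_re]
  congr 1
  simp only [evalC, Prod.fst_add, Prod.snd_add, Pi.add_apply, map_add, Complex.ofReal_add]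
  rw [add_add_add_comm, ← Finset.sum_add_distrib]
  congr 1
  exact Finset.sum_congr rfl fun k _ => by ring

lemma evalR_smul {n : ℕ} (a : ℝ) (p : Coef n) (z : ℂ) : evalR (a • p) z = a * evalR p z := by
  rw [evalR, evalR, ← Complex.re_ofReal_mul]
  congr 1
  simp only [evalC, Prod.smul_fst, Prod.smul_snd, Pi.smul_apply, Complex.real_smul, map_mul,
    Complex.conj_ofReal, smul_eq_mul, Complex.ofReal_mul, mul_add, Finset.mul_sum, mul_assoc]

lemma pairCP_add {n : ℕ} (c p q : Coef n) : pairCP c (p + q) = pairCP c p + pairCP c q := by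
  simp only [pairCP, Prod.fst_add, Prod.snd_add, Pi.add_apply, map_add, mul_add, Complex.add_re]
  rw [Finset.sum_add_distrib]
  ring

lemma pairCP_smul {n : ℕ} (a : ℝ) (c p : Coef n) : pairCP c (a • p) = a * pairCP c p := by
  simp only [pairCP, Prod.smul_fst, Prod.smul_snd, Pi.smul_apply, Complex.real_smul, map_mul,
    Complex.conj_ofReal, smul_eq_mul, mul_add, Finset.mul_sum]
  congr 1
  · ring
  · refine Finset.sum_congr rfl fun k _ => ?_
    rw [mul_left_comm (c.2 k), Complex.re_ofReal_mul]
    ring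

/-- Distinct trigonometric polynomials of degree `n < N` differ at some `2N`-th root of unity. -/
lemma exists_evalR_zet_ne {n N : ℕ} (hnN : n < N) {p q : Coef n} (hpq : p ≠ q) :
    ∃ j ∈ idxs N, evalR p (zet N j) ≠ evalR q (zet N j) := by
  by_contra! h
  refine hpq (sub_eq_zero.mp (eq_zero_of_evalR_zet_eq_zero hnN _ fun j hj => ?_))
  have := evalR_add (p - q) q (zet N j)
  rw [sub_add_cancel, h j hj] at this
  linarith

/-- For every `c` and every `P ∈ 𝔓₊(N)`, the dual functional `J_P` is
strictly convex on the open convex cone `𝔓₊(N)`. -/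
theorem JP_strictConvexOn
    (n N : ℕ) (hn : 1 ≤ n) (hnN : n < N)
    (c : Coef n) (P : Coef n) (hP : P ∈ Pplus n N) :
    ∀ Q₁ ∈ Pplus n N, ∀ Q₂ ∈ Pplus n N, Q₁ ≠ Q₂ → ∀ t : ℝ, 0 < t → t < 1 →
      JP N c P (t • Q₁ + (1 - t) • Q₂) < t * JP N c P Q₁ + (1 - t) * JP N c P Q₂ := by
  intro Q₁ hQ₁ Q₂ hQ₂ hne t ht ht'
  have hs : 0 < 1 - t := sub_pos.mpr ht'
  have key : ∑ j ∈ idxs N, evalR P (zet N j) *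
        (t * Real.log (evalR Q₁ (zet N j)) + (1 - t) * Real.log (evalR Q₂ (zet N j))) <
      ∑ j ∈ idxs N, evalR P (zet N j) *
        Real.log (evalR (t • Q₁ + (1 - t) • Q₂) (zet N j)) := by
    simp only [evalR_add, evalR_smul]
    refine Finset.sum_lt_sum (fun j hj => ?_) ?_
    · exact mul_le_mul_of_nonneg_left (strictConcaveOn_log_Ioi.concaveOn.2 (hQ₁ j hj) (hQ₂ j hj)
        ht.le hs.le (add_sub_cancel t 1)) (hP j hj).le
    · obtain ⟨j, hj, hj'⟩ := exists_evalR_zet_ne hnN hne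
      exact ⟨j, hj, mul_lt_mul_of_pos_left (strictConcaveOn_log_Ioi.2 (hQ₁ j hj) (hQ₂ j hj) hj'
        ht hs (add_sub_cancel t 1)) (hP j hj)⟩
  have hN : 0 < 1 / (2 * (N : ℝ)) := by
    have : 0 < (N : ℝ) := by exact_mod_cast (show 0 < N by omega)
    positivity
  have key' := mul_lt_mul_of_pos_left key hN
  simp only [mul_add, mul_left_comm _ t, mul_left_comm _ (1 - t), Finset.sum_add_distrib,
    ← Finset.mul_sum] at key'
  simp only [JP, pairCP_add, pairCP_smul]
  linarith
end
end

section
/- Let c ∈ ℭ_+(N). For each P ∈ 𝔓_+(N), let G^c(P) denote the unique Q ∈ 𝔓_+(N) with F^P(Q) = c (which exists and is unique). Then the map G^c : 𝔓_+(N) → 𝔓_+(N) is a homeomorphism of 𝔓_+(N) onto its image; i.e., G^c is injective, continuous, and its inverse (defined on the image) is continuous. -/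
open Complex Finset Filter Topology

noncomputable section

/-- Pointwise values of positive data satisfying a common moment identity: if `P → P₀`, then
`Q → Q₀`. -/
lemma tendsto_denominator {α ι : Type*} [Fintype ι] {l : Filter α} {P Q : α → ι → ℝ}
    {P₀ Q₀ : ι → ℝ} (hP : ∀ x j, 0 < P x j) (hQ : ∀ x j, 0 < Q x j)
    (hP₀ : ∀ j, 0 < P₀ j) (hQ₀ : ∀ j, 0 < Q₀ j)
    (hsum : ∀ x, ∑ j, P x j / Q x j = ∑ j, P₀ j / Q₀ j)
    (horth : ∀ x, ∑ j, (P x j / Q x j - P₀ j / Q₀ j) * (Q x j - Q₀ j) = 0)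
    (hlim : Tendsto P l (𝓝 P₀)) : Tendsto Q l (𝓝 Q₀) := by
  set K := ∑ j, P₀ j / Q₀ j
  have hratio (x : α) (j : ι) : P x j / Q x j ≤ K := by
    rw [← hsum x]
    exact single_le_sum (f := fun i => P x i / Q x i)
      (fun i _ => (div_pos (hP x i) (hQ x i)).le) (mem_univ j)
  set S : α → ℝ := fun x => ∑ j, |P x j - P₀ j| * (1 + Q₀ j * (K / P x j))
  have hS : Tendsto S l (𝓝 0) := by
    have h : Tendsto S l (𝓝 (∑ j, |P₀ j - P₀ j| * (1 + Q₀ j * (K / P₀ j)))) := by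
      refine tendsto_finsetSum _ fun j _ => ?_
      have hj := tendsto_pi_nhds.1 hlim j
      exact (hj.sub_const _).abs.mul
        ((((tendsto_const_nhds.div hj (hP₀ j).ne').const_mul _)).const_add _)
    simpa using h
  have hweighted (x : α) (j : ι) : P₀ j * (Q x j - Q₀ j) ^ 2 / (Q x j * Q₀ j) ≤ S x := by
    calc
      _ ≤ ∑ i, P₀ i * (Q x i - Q₀ i) ^ 2 / (Q x i * Q₀ i) :=
        single_le_sum (f := fun i => P₀ i * (Q x i - Q₀ i) ^ 2 / (Q x i * Q₀ i))
          (fun i _ => div_nonneg (mul_nonneg (hP₀ i).le (sq_nonneg _))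
            (mul_pos (hQ x i) (hQ₀ i)).le) (mem_univ j)
      _ = ∑ i, (P x i - P₀ i) * ((Q x i - Q₀ i) / Q x i) := by
        rw [← sub_eq_zero, ← neg_eq_zero, ← horth x, ← sum_sub_distrib, ← sum_neg_distrib]
        refine sum_congr rfl fun i _ => ?_
        have := (hQ x i).ne'
        have := (hQ₀ i).ne'
        field_simp
        ring
      _ ≤ S x := by
        refine sum_le_sum fun i _ => ?_
        refine (le_abs_self _).trans ?_
        rw [abs_mul]
        refine mul_le_mul_of_nonneg_left ?_ (abs_nonneg _)
        have hq := hQ x i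
        have hinv : 1 / Q x i ≤ K / P x i := by
          rw [div_le_div_iff₀ hq (hP x i)]
          have := (div_le_iff₀ hq).1 (hratio x i)
          linarith
        calc |(Q x i - Q₀ i) / Q x i| = |1 - Q₀ i * (1 / Q x i)| := by
              congr 1
              field_simp
          _ ≤ |(1 : ℝ)| + |Q₀ i * (1 / Q x i)| := abs_sub _ _
          _ = 1 + Q₀ i * (1 / Q x i) := by
              rw [abs_one, abs_of_pos (mul_pos (hQ₀ i) (one_div_pos.2 hq))]
          _ ≤ _ := by
              gcongr
              exact (hQ₀ i).le
  refine tendsto_pi_nhds.2 fun j => ?_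
  set T : α → ℝ := fun x => S x * (Q₀ j / P₀ j)
  have hT : Tendsto T l (𝓝 0) := by simpa using hS.mul_const (Q₀ j / P₀ j)
  have hbound (x : α) : (Q x j - Q₀ j) ^ 2 ≤ 2 * T x * Q₀ j + T x ^ 2 := by
    have hp := hP₀ j
    have hq := hQ x j
    have hq₀ := hQ₀ j
    have hle : (Q x j - Q₀ j) ^ 2 ≤ T x * Q x j := by
      have h := (div_le_iff₀ (mul_pos hq hq₀)).1 (hweighted x j)
      have hTx : T x * Q x j = S x * (Q x j * Q₀ j) / P₀ j := by
        simp only [T]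
        ring
      rw [hTx, le_div_iff₀ hp]
      linarith
    nlinarith [sq_nonneg (Q x j - Q₀ j - T x)]
  have hsq : Tendsto (fun x => (Q x j - Q₀ j) ^ 2) l (𝓝 0) := by
    refine squeeze_zero (fun x => sq_nonneg _) hbound ?_
    simpa using ((hT.const_mul 2).mul_const (Q₀ j)).add (hT.pow 2)
  rw [tendsto_iff_norm_sub_tendsto_zero]
  simpa [Real.sqrt_sq_eq_abs] using hsq.sqrt

/-- Pointwise values of positive data satisfying a common moment identity: if `Q → Q₀`, then
`P → P₀`. -/
lemma tendsto_numerator {α ι : Type*} [Fintype ι] {l : Filter α} {P Q : α → ι → ℝ}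
    {P₀ Q₀ : ι → ℝ} (hP : ∀ x j, 0 < P x j) (hQ : ∀ x j, 0 < Q x j)
    (hP₀ : ∀ j, 0 < P₀ j) (hQ₀ : ∀ j, 0 < Q₀ j)
    (hsum : ∀ x, ∑ j, P x j / Q x j = ∑ j, P₀ j / Q₀ j)
    (horth : ∀ x, ∑ j, (P x j / Q x j - P₀ j / Q₀ j) * (P x j - P₀ j) = 0)
    (hlim : Tendsto Q l (𝓝 Q₀)) : Tendsto P l (𝓝 P₀) := by
  set K := ∑ j, P₀ j / Q₀ j
  have hratio (x : α) (j : ι) : P x j / Q x j ≤ K := by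
    rw [← hsum x]
    exact single_le_sum (f := fun i => P x i / Q x i)
      (fun i _ => (div_pos (hP x i) (hQ x i)).le) (mem_univ j)
  set S : α → ℝ := fun x => ∑ j, P₀ j * |Q x j - Q₀ j| / (Q₀ j * Q x j) * (K * Q x j + P₀ j)
  have hS : Tendsto S l (𝓝 0) := by
    have h : Tendsto S l
        (𝓝 (∑ j, P₀ j * |Q₀ j - Q₀ j| / (Q₀ j * Q₀ j) * (K * Q₀ j + P₀ j))) := by
      refine tendsto_finsetSum _ fun j _ => ?_
      have hj := tendsto_pi_nhds.1 hlim j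
      exact (((hj.sub_const _).abs.const_mul _).div (hj.const_mul _)
        (mul_pos (hQ₀ j) (hQ₀ j)).ne').mul ((hj.const_mul _).add_const _)
    simpa using h
  have hweighted (x : α) (j : ι) : (P x j - P₀ j) ^ 2 / Q x j ≤ S x := by
    calc
      _ ≤ ∑ i, (P x i - P₀ i) ^ 2 / Q x i :=
        single_le_sum (f := fun i => (P x i - P₀ i) ^ 2 / Q x i)
          (fun i _ => div_nonneg (sq_nonneg _) (hQ x i).le) (mem_univ j)
      _ = ∑ i, P₀ i * (Q x i - Q₀ i) / (Q₀ i * Q x i) * (P x i - P₀ i) := by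
        rw [← sub_eq_zero, ← horth x, ← sum_sub_distrib]
        refine sum_congr rfl fun i _ => ?_
        have := (hQ x i).ne'
        have := (hQ₀ i).ne'
        field_simp
        ring
      _ ≤ S x := by
        refine sum_le_sum fun i _ => ?_
        refine (le_abs_self _).trans ?_
        have hq := hQ x i
        have hq₀ := hQ₀ i
        rw [abs_mul, abs_div, abs_mul, abs_of_pos (hP₀ i), abs_of_pos (mul_pos hq₀ hq)]
        refine mul_le_mul_of_nonneg_left ?_
          (div_nonneg (mul_nonneg (hP₀ i).le (abs_nonneg _)) (mul_pos hq₀ hq).le)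
        have h := (div_le_iff₀ hq).1 (hratio x i)
        have hp := hP x i
        have hp₀ := hP₀ i
        rw [abs_le]
        constructor <;> linarith
  refine tendsto_pi_nhds.2 fun j => ?_
  have hsq : Tendsto (fun x => (P x j - P₀ j) ^ 2) l (𝓝 0) := by
    refine squeeze_zero (g := fun x => S x * Q x j) (fun x => sq_nonneg _)
      (fun x => (div_le_iff₀ (hQ x j)).1 (hweighted x j)) ?_
    simpa using hS.mul (tendsto_pi_nhds.1 hlim j)
  rw [tendsto_iff_norm_sub_tendsto_zero]
  simpa [Real.sqrt_sq_eq_abs] using hsq.sqrt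

lemma zet_eq_zpow (N : ℕ) (j : ℤ) :
    zet N j = Complex.exp (2 * Real.pi * Complex.I / ((2 * N : ℕ) : ℂ)) ^ j := by
  rw [zet, ← Complex.exp_int_mul]
  congr 1
  push_cast
  rw [mul_assoc (2 : ℂ), mul_div_mul_left _ _ two_ne_zero]
  ring

lemma zet_inv (N : ℕ) (j : ℤ) : (zet N j)⁻¹ = (starRingEnd ℂ) (zet N j) := by
  rw [zet, ← Complex.exp_neg, ← Complex.exp_conj]
  congr 1
  simp [neg_div]

/-- Discrete orthogonality of the characters of the `2N`-th roots of unity. -/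
lemma sum_zet_zpow_eq_zero {N : ℕ} (hN : 0 < N) {m : ℤ} (hm : ¬ (2 * N : ℤ) ∣ m) :
    ∑ j ∈ idxs N, zet N j ^ m = 0 := by
  have hprim := Complex.isPrimitiveRoot_exp (2 * N) (by omega)
  set ξ := Complex.exp (2 * Real.pi * Complex.I / ((2 * N : ℕ) : ℂ)) with hξ
  have hξ0 : ξ ≠ 0 := Complex.exp_ne_zero _
  have hw : ξ ^ m ≠ 1 := by
    rw [Ne, hprim.zpow_eq_one_iff_dvd]
    simpa using hm
  have hshift : ∑ j ∈ idxs N, zet N j ^ m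
      = ∑ i ∈ range (2 * N), (ξ ^ m) ^ (-(N : ℤ) + 1) * (ξ ^ m) ^ i := by
    symm
    refine sum_bij (fun i _ => (i : ℤ) - N + 1) ?_ ?_ ?_ ?_
    · intro i hi
      simp only [idxs, mem_Icc, mem_range] at hi ⊢
      omega
    · intro a _ b _ h
      omega
    · intro b hb
      simp only [idxs, mem_Icc] at hb
      exact ⟨(b + N - 1).toNat, by simp only [mem_range]; omega, by omega⟩
    · intro i _
      rw [zet_eq_zpow, ← hξ, ← zpow_natCast (ξ ^ m), ← zpow_add₀ (zpow_ne_zero _ hξ0),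
        ← zpow_mul, ← zpow_mul]
      congr 1
      ring
  rw [hshift, ← mul_sum, geom_sum_eq hw]
  have : (ξ ^ m) ^ (2 * N) = 1 := by
    rw [← zpow_natCast, ← zpow_mul, mul_comm, zpow_mul, zpow_natCast, hprim.pow_eq_one, one_zpow]
  simp [this]

lemma evalC_eq_evalR {n : ℕ} (p : Coef n) (N : ℕ) (j : ℤ) :
    evalC p (zet N j) = (evalR p (zet N j) : ℂ) := by
  symm
  rw [evalR, ← Complex.conj_eq_iff_re]
  simp only [evalC, zet_inv, map_add, map_sum, map_mul, map_pow, Complex.conj_conj,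
    Complex.conj_ofReal]
  congr 1
  exact sum_congr rfl fun k _ => add_comm _ _

lemma evalR_zet {n : ℕ} (p : Coef n) (N : ℕ) (j : ℤ) :
    evalR p (zet N j)
      = p.1 + ∑ k : Fin n, 2 * (zet N j ^ ((k : ℕ) + 1) * (starRingEnd ℂ) (p.2 k)).re := by
  simp only [evalR, evalC, zet_inv, Complex.add_re, Complex.re_sum, Complex.ofReal_re]
  congr 1
  refine sum_congr rfl fun k _ => ?_
  rw [← map_pow, mul_comm ((starRingEnd ℂ) (p.2 k)),
    ← Complex.conj_re (p.2 k * (starRingEnd ℂ) (zet N j ^ ((k : ℕ) + 1)))]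
  simp only [map_mul, Complex.conj_conj]
  ring_nf

/-- Evaluation of a trigonometric polynomial at the `2N`-th roots of unity. -/
def evalRootsLinear (n N : ℕ) : Coef n →ₗ[ℝ] (idxs N → ℝ) where
  toFun p j := evalR p (zet N j)
  map_add' p q := by
    ext j
    simp only [evalR_zet, Pi.add_apply, Prod.fst_add, Prod.snd_add, map_add, mul_add,
      Complex.add_re, sum_add_distrib]
    ring
  map_smul' a p := by
    ext j
    simp only [evalR_zet, Pi.smul_apply, Prod.smul_fst, Prod.smul_snd, smul_eq_mul,
      Complex.real_smul, map_mul, Complex.conj_ofReal, RingHom.id_apply, mul_add, mul_sum]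
    congr 1
    refine sum_congr rfl fun k _ => ?_
    rw [mul_left_comm _ (a : ℂ), Complex.re_ofReal_mul]
    ring

lemma sum_zet_pow_mul_evalC {n N : ℕ} (hnN : n < N) (p : Coef n) (k : ℕ) (hk : k ≤ n) :
    ∑ j ∈ idxs N, zet N j ^ k * evalC p (zet N j)
      = 2 * N * (if k = 0 then (p.1 : ℂ) else ∑ m : Fin n, if (m : ℕ) + 1 = k then p.2 m else 0) := by
  have hN : 0 < N := by omega
  have hchar (m : ℤ) (h : |m| < 2 * N) :
      ∑ j ∈ idxs N, zet N j ^ m = if m = 0 then 2 * (N : ℂ) else 0 := by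
    split_ifs with h0
    · subst h0
      simp only [zpow_zero, sum_const, idxs, Int.card_Icc, nsmul_eq_mul, mul_one]
      have : ((N : ℤ) + 1 - (-(N : ℤ) + 1)).toNat = 2 * N := by omega
      rw [this]
      push_cast
      rfl
    · exact sum_zet_zpow_eq_zero hN fun hd => h0 (Int.eq_zero_of_abs_lt_dvd hd h)
  have hexpand (j : ℤ) : zet N j ^ k * evalC p (zet N j) = p.1 * zet N j ^ (k : ℤ)
      + ∑ m : Fin n, (p.2 m * zet N j ^ ((k : ℤ) - ((m : ℕ) + 1))
        + (starRingEnd ℂ) (p.2 m) * zet N j ^ ((k : ℤ) + ((m : ℕ) + 1))) := by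
    rw [evalC, mul_add, mul_sum]
    congr 1
    · rw [zpow_natCast, mul_comm]
    · refine sum_congr rfl fun m _ => ?_
      rw [zpow_sub₀ (zet_ne_zero N j), zpow_add₀ (zet_ne_zero N j)]
      norm_cast
      simp only [inv_pow, div_eq_mul_inv]
      ring
  simp only [hexpand]
  rw [sum_add_distrib, sum_comm, ← mul_sum, hchar _ (by rw [abs_lt]; constructor <;> omega)]
  simp only [sum_add_distrib, ← mul_sum]
  have h1 (m : Fin n) : ∑ j ∈ idxs N, zet N j ^ ((k : ℤ) - ((m : ℕ) + 1))
      = if (m : ℕ) + 1 = k then 2 * (N : ℂ) else 0 := by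
    rw [hchar _ (by rw [abs_lt]; constructor <;> omega)]
    exact if_congr (by omega) rfl rfl
  have h2 (m : Fin n) : ∑ j ∈ idxs N, zet N j ^ ((k : ℤ) + ((m : ℕ) + 1)) = 0 := by
    rw [hchar _ (by rw [abs_lt]; constructor <;> omega), if_neg (by omega)]
  simp only [h1, h2, mul_zero, sum_const_zero, add_zero]
  by_cases hk0 : k = 0
  · subst hk0
    simp [mul_comm]
  · simp [hk0, mul_sum, mul_comm]

lemma evalRootsLinear_injective {n N : ℕ} (hnN : n < N) :
    Function.Injective (evalRootsLinear n N) := by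
  rw [injective_iff_map_eq_zero]
  intro p hp
  have hzero (j : ℤ) (hj : j ∈ idxs N) : evalC p (zet N j) = 0 := by
    have h : evalR p (zet N j) = 0 := congrFun hp ⟨j, hj⟩
    rw [evalC_eq_evalR, h, Complex.ofReal_zero]
  have hcoef (k : ℕ) (hk : k ≤ n) :
      (if k = 0 then (p.1 : ℂ) else ∑ m : Fin n, if (m : ℕ) + 1 = k then p.2 m else 0) = 0 := by
    have h := sum_zet_pow_mul_evalC hnN p k hk
    rw [sum_eq_zero fun j hj => by rw [hzero j hj, mul_zero]] at h
    have hN : (2 * N : ℂ) ≠ 0 := by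
      norm_cast
      omega
    exact (mul_eq_zero.1 h.symm).resolve_left hN
  refine Prod.ext ?_ (funext fun m => ?_)
  · simpa using hcoef 0 (Nat.zero_le _)
  · simpa [Fin.val_inj] using hcoef (m + 1) (by omega)

/-- Prescribing the moments amounts to prescribing the pairing with every trigonometric
polynomial. -/
lemma sum_phiOf_mul_evalR {n N : ℕ} (hN : 0 < N) {c P Q : Coef n} (h : Fmap N P Q = c)
    (R : Coef n) :
    ∑ j : idxs N, evalRootsLinear n N P j / evalRootsLinear n N Q j * evalRootsLinear n N R j
      = 2 * N * pairCP c R := by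
  have hN' : (N : ℂ) ≠ 0 := by exact_mod_cast hN.ne'
  have hdmom (Φ : ℤ → ℝ) (k : ℤ) : ∑ j ∈ idxs N, zet N j ^ k * (Φ j : ℂ) = 2 * N * dmom N Φ k := by
    rw [dmom]
    field_simp
  have hmul (z : ℂ) : ((2 * N * z : ℂ)).re = 2 * N * z.re := by
    rw [← Complex.re_ofReal_mul]
    push_cast
    rfl
  change ∑ j : idxs N, phiOf N P Q j * evalR R (zet N j) = _
  rw [sum_coe_sort (idxs N) fun j => phiOf N P Q j * evalR R (zet N j), ← h]
  simp only [pairCP, Fmap, evalR_zet, mul_add, mul_sum, sum_add_distrib]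
  congr 1
  · have h0 := congrArg Complex.re (hdmom (phiOf N P Q) 0)
    rw [hmul] at h0
    simp only [zpow_zero, one_mul, Complex.re_sum, Complex.ofReal_re] at h0
    rw [← sum_mul, h0]
    ring
  · rw [sum_comm]
    refine sum_congr rfl fun k _ => ?_
    have hk := congrArg (fun z => 2 * (z * (starRingEnd ℂ) (R.2 k)).re)
      (hdmom (phiOf N P Q) ((k : ℕ) + 1))
    rw [mul_assoc (2 * N : ℂ), hmul, sum_mul, Complex.re_sum, mul_sum] at hk
    rw [mul_left_comm, ← hk]
    refine sum_congr rfl fun j _ => ?_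
    rw [mul_right_comm, mul_comm _ ((phiOf N P Q j : ℝ) : ℂ), Complex.re_ofReal_mul]
    norm_cast
    ring

/-- For solutions of the moment equation `F^P(Q) = c` with `c` fixed, convergence of the
numerators is equivalent to convergence of the denominators. -/
lemma tendsto_numerator_iff_tendsto_denominator {n N : ℕ} (hnN : n < N) {c : Coef n} {α : Type*}
    {l : Filter α} {P Q : α → Coef n} {P₀ Q₀ : Coef n}
    (hP : ∀ x, P x ∈ Pplus n N) (hQ : ∀ x, Q x ∈ Pplus n N) (hF : ∀ x, Fmap N (P x) (Q x) = c)
    (hP₀ : P₀ ∈ Pplus n N) (hQ₀ : Q₀ ∈ Pplus n N) (hF₀ : Fmap N P₀ Q₀ = c) :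
    Tendsto P l (𝓝 P₀) ↔ Tendsto Q l (𝓝 Q₀) := by
  have hN : 0 < N := by omega
  set E := evalRootsLinear n N with hE
  have hind := (E.isClosedEmbedding_of_injective
    (LinearMap.ker_eq_bot.2 (evalRootsLinear_injective hnN))).isInducing
  have hpos {p : Coef n} (hp : p ∈ Pplus n N) (j : idxs N) : 0 < E p j := hp j j.2
  have horth (x : α) (R : Coef n) :
      ∑ j, (E (P x) j / E (Q x) j - E P₀ j / E Q₀ j) * E R j = 0 := by
    simp only [sub_mul, sum_sub_distrib]
    rw [sum_phiOf_mul_evalR hN (hF x), sum_phiOf_mul_evalR hN hF₀, sub_self]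
  have hsum (x : α) : ∑ j, E (P x) j / E (Q x) j = ∑ j, E P₀ j / E Q₀ j := by
    have h1 (j : idxs N) : E (1, 0) j = 1 := by
      change evalR ((1, 0) : Coef n) (zet N j) = 1
      simp [evalR_zet]
    have h := horth x (1, 0)
    simp only [h1, mul_one, sum_sub_distrib] at h
    exact sub_eq_zero.1 h
  rw [hind.tendsto_nhds_iff, hind.tendsto_nhds_iff]
  constructor
  · refine tendsto_denominator (fun x => hpos (hP x)) (fun x => hpos (hQ x)) (hpos hP₀)
      (hpos hQ₀) hsum fun x => ?_
    simpa only [map_sub, Pi.sub_apply, Function.comp_apply] using horth x (Q x - Q₀)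
  · refine tendsto_numerator (fun x => hpos (hP x)) (fun x => hpos (hQ x)) (hpos hP₀)
      (hpos hQ₀) hsum fun x => ?_
    simpa only [map_sub, Pi.sub_apply, Function.comp_apply] using horth x (P x - P₀)

/-- **Theorem 3, second part.** For fixed `c ∈ ℭ₊(N)`, the map
`G^c : P ↦ Q` (where `Q` is the unique solution of `F^P(Q) = c`) is a homeomorphism
of `𝔓₊(N)` onto its image. -/
theorem Gmap_homeomorphism
    (n N : ℕ) (hn : 1 ≤ n) (hnN : n < N)
    (c : Coef n) (hc : c ∈ Cplus n N) (G : Coef n → Coef n)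
    (hG : ∀ P ∈ Pplus n N, G P ∈ Pplus n N ∧ Fmap N P (G P) = c)
    (hGuniq : ∀ P ∈ Pplus n N, ∀ Q ∈ Pplus n N, Fmap N P Q = c → Q = G P) :
    ∃ H : (Pplus n N) ≃ₜ (G '' (Pplus n N)),
      ∀ P : Pplus n N, (H P : Coef n) = G (P : Coef n) := by
  have key {α : Type} {l : Filter α} (P : α → Pplus n N) (P₀ : Pplus n N) :
      Tendsto P l (𝓝 P₀) ↔ Tendsto (fun x => G (P x)) l (𝓝 (G P₀)) := by
    rw [tendsto_subtype_rng]
    exact tendsto_numerator_iff_tendsto_denominator hnN (fun x => (P x).2)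
      (fun x => (hG _ (P x).2).1) (fun x => (hG _ (P x).2).2) P₀.2 (hG _ P₀.2).1 (hG _ P₀.2).2
  have hemb : IsEmbedding fun P : Pplus n N => G P := by
    refine ⟨isInducing_iff_nhds.2 fun P₀ => le_antisymm ?_ ?_, fun P₁ P₂ h => ?_⟩
    · exact tendsto_iff_comap.1 ((key id P₀).1 tendsto_id)
    · exact (key id P₀).2 tendsto_comap
    · refine tendsto_const_nhds_iff.1 ((key (l := (pure () : Filter Unit)) (fun _ => P₁) P₂).2 ?_)
      exact tendsto_const_nhds_iff.2 h
  exact ⟨hemb.toHomeomorph.trans (Homeomorph.setCongr (Set.image_eq_range G (Pplus n N)).symm),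
    fun _ => rfl⟩
end
end

section
/- Let c ∈ ℭ_+ and P ∈ 𝔓_+. Suppose Q ∈ 𝔓_+ is the unique element of 𝔓_+ satisfying the continuous moment conditions c_k = ∫_{-π}^{π} e^{ikθ} P(e^{iθ})/Q(e^{iθ}) dθ/(2π) for k = 0, 1, …, n. For each N > n with c ∈ ℭ_+(N), let Q_N ∈ 𝔓_+(N) be the unique element of 𝔓_+(N) satisfying the discrete moment conditions c_k = (1/(2N)) Σ_{j=-N+1}^{N} (ζ_j^{(N)})^k · P(ζ_j^{(N)})/Q_N(ζ_j^{(N)}) for k = 0, 1, …, n. Then Q_N → Q (coefficientwise) as N → ∞. -/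
open Complex Finset Filter Topology

noncomputable section

/-- The continuous moment `∫_{-π}^{π} e^{ikθ} P(e^{iθ})/Q(e^{iθ}) dθ/(2π)`. -/
def cmom {n : ℕ} (P Q : Coef n) (k : ℤ) : ℂ :=
  (1 / (2 * (Real.pi : ℂ))) * ∫ θ in (-Real.pi)..Real.pi,
    Complex.exp (Complex.I * (k : ℂ) * (θ : ℂ)) *
      ((evalR P (Complex.exp (θ * Complex.I)) / evalR Q (Complex.exp (θ * Complex.I)) : ℝ) : ℂ)

/-- `Q` satisfies the continuous moment conditions for `c` (with numerator `P`). -/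
def CMomCond {n : ℕ} (c P Q : Coef n) : Prop :=
  cmom P Q 0 = (c.1 : ℂ) ∧ ∀ k : Fin n, cmom P Q ((k : ℕ) + 1) = c.2 k

lemma sum_idxs {M : Type*} [AddCommMonoid M] (N : ℕ) (F : ℤ → M) :
    ∑ j ∈ idxs N, F j = ∑ i ∈ range (2 * N), F (-(N : ℤ) + 1 + i) := by
  symm
  refine Finset.sum_bij (fun i _ => -(N : ℤ) + 1 + i) ?_ ?_ ?_ (fun _ _ => rfl)
  · intro i hi
    simp only [idxs, Finset.mem_Icc, Finset.mem_range] at *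
    omega
  · intro i _ j _ h
    simpa using h
  · intro j hj
    simp only [idxs, Finset.mem_Icc] at hj
    refine ⟨(j + N - 1).toNat, ?_, ?_⟩
    · simp only [Finset.mem_range]; omega
    · omega

/-- Right-endpoint Riemann sums over `[-π, π]` converge to the normalised integral. -/
lemma tendsto_average_idxs {f : ℝ → ℂ} (hf : ContinuousOn f (Set.Icc (-Real.pi) Real.pi)) :
    Tendsto (fun N : ℕ => (1 / (2 * (N : ℂ))) * ∑ j ∈ idxs N, f (Real.pi * j / N)) atTop
      (𝓝 ((1 / (2 * (Real.pi : ℂ))) * ∫ θ in (-Real.pi)..Real.pi, f θ)) := by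
  have hpi := Real.pi_pos
  rw [Metric.tendsto_atTop]
  intro ε hε
  have huc := isCompact_Icc.uniformContinuousOn_of_continuous hf
  rw [Metric.uniformContinuousOn_iff] at huc
  obtain ⟨δ, hδ, hδ'⟩ := huc (ε / 2) (by positivity)
  obtain ⟨N₀, hN₀⟩ := exists_nat_gt (Real.pi / δ)
  refine ⟨N₀ + 1, fun N hN => ?_⟩
  have hNN : (N₀ : ℝ) + 1 ≤ N := by exact_mod_cast hN
  have hN0 : (0 : ℝ) < N := by have := N₀.cast_nonneg (α := ℝ); linarith
  have hstep : Real.pi / N < δ := by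
    rw [div_lt_iff₀ hN0]
    rw [div_lt_iff₀ hδ] at hN₀
    nlinarith
  set a : ℕ → ℝ := fun i => -Real.pi + Real.pi / N * i with ha
  have ha0 : a 0 = -Real.pi := by simp [ha]
  have ha1 : a (2 * N) = Real.pi := by
    simp only [ha]; push_cast; field_simp; ring
  have hamono : Monotone a := by
    intro i j hij
    simp only [ha]
    have : (i : ℝ) ≤ j := by exact_mod_cast hij
    gcongr
  have hsucc : ∀ i, a (i + 1) = a i + Real.pi / N := by
    intro i; simp only [ha]; push_cast; ring
  have hmem : ∀ i, i ≤ 2 * N → a i ∈ Set.Icc (-Real.pi) Real.pi := fun i hi =>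
    ⟨ha0 ▸ hamono (Nat.zero_le i), ha1 ▸ hamono hi⟩
  have hint : ∀ i < 2 * N, IntervalIntegrable f MeasureTheory.volume (a i) (a (i + 1)) := by
    intro i hi
    refine (hf.mono ?_).intervalIntegrable
    rw [Set.uIcc_of_le (hamono (Nat.le_succ i))]
    exact Set.Icc_subset_Icc (hmem i hi.le).1 (hmem (i + 1) hi).2
  have hsplit := intervalIntegral.sum_integral_adjacent_intervals hint
  rw [ha0, ha1] at hsplit
  have hsum : ∑ j ∈ idxs N, f (Real.pi * j / N) = ∑ i ∈ range (2 * N), f (a (i + 1)) := by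
    rw [sum_idxs]
    refine Finset.sum_congr rfl fun i _ => ?_
    congr 1
    simp only [ha]; push_cast; field_simp; ring
  have hpc : (Real.pi : ℂ) ≠ 0 := by exact_mod_cast hpi.ne'
  have hNc : (N : ℂ) ≠ 0 := by exact_mod_cast hN0.ne'
  have hdiff : (1 / (2 * (N : ℂ))) * ∑ j ∈ idxs N, f (Real.pi * j / N) -
      (1 / (2 * (Real.pi : ℂ))) * ∫ θ in (-Real.pi)..Real.pi, f θ =
      (1 / (2 * (Real.pi : ℂ))) *
        ∑ i ∈ range (2 * N), ∫ θ in a i..a (i + 1), (f (a (i + 1)) - f θ) := by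
    rw [hsum, ← hsplit, Finset.mul_sum, Finset.mul_sum, Finset.mul_sum, ← Finset.sum_sub_distrib]
    refine Finset.sum_congr rfl fun i hi => ?_
    rw [intervalIntegral.integral_sub intervalIntegrable_const (hint i (Finset.mem_range.1 hi)),
      intervalIntegral.integral_const, hsucc, add_sub_cancel_left, Complex.real_smul]
    push_cast
    field_simp
  have hbound : ∀ i ∈ range (2 * N),
      ‖∫ θ in a i..a (i + 1), (f (a (i + 1)) - f θ)‖ ≤ ε / 2 * (Real.pi / N) := by
    intro i hi
    rw [Finset.mem_range] at hi
    have hle := hamono (Nat.le_succ i)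
    have h := intervalIntegral.norm_integral_le_of_norm_le_const (a := a i) (b := a (i + 1))
      (f := fun θ => f (a (i + 1)) - f θ) (C := ε / 2) ?_
    · rwa [hsucc, add_sub_cancel_left, abs_of_pos (by positivity), ← hsucc] at h
    · intro θ hθ
      rw [Set.uIoc_of_le hle] at hθ
      rw [← dist_eq_norm]
      refine (hδ' _ (hmem _ hi) _ ⟨(hmem i hi.le).1.trans hθ.1.le, hθ.2.trans (hmem _ hi).2⟩ ?_).le
      rw [Real.dist_eq, abs_of_nonneg (by linarith [hθ.2])]
      have := hsucc i
      linarith [hθ.1]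
  rw [dist_eq_norm, hdiff, norm_mul]
  have hs := (norm_sum_le _ _).trans (Finset.sum_le_sum hbound)
  rw [Finset.sum_const, Finset.card_range, nsmul_eq_mul] at hs
  have hn : ‖(1 / (2 * (Real.pi : ℂ)))‖ = 1 / (2 * Real.pi) := by
    simp [abs_of_pos hpi]
  rw [hn]
  calc _ ≤ 1 / (2 * Real.pi) * (((2 * N : ℕ) : ℝ) * (ε / 2 * (Real.pi / N))) := by gcongr
    _ = ε / 2 := by push_cast; field_simp
    _ < ε := by linarith

lemma zet_eq (N : ℕ) (j : ℤ) :
    zet N j = Complex.exp (((Real.pi * j / N : ℝ) : ℂ) * Complex.I) := by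
  rw [zet]
  congr 1
  push_cast
  ring

lemma node_mem {N : ℕ} {j : ℤ} (hj : j ∈ idxs N) :
    Real.pi * j / N ∈ Set.Icc (-Real.pi) Real.pi := by
  simp only [idxs, Finset.mem_Icc] at hj
  have hN : (0 : ℝ) < N := by
    have : 0 < N := by omega
    exact_mod_cast this
  have h1 : -(N : ℝ) ≤ j := by
    have : -(N : ℤ) ≤ j := by omega
    exact_mod_cast this
  have h2 : (j : ℝ) ≤ N := by exact_mod_cast hj.2
  have hpi := Real.pi_pos
  constructor
  · rw [le_div_iff₀ hN]; nlinarith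
  · rw [div_le_iff₀ hN]; nlinarith

lemma zet_zpow (N : ℕ) (j m : ℤ) : zet N j ^ m = (zet N 1 ^ m) ^ j := by
  simp only [zet, ← Complex.exp_int_mul]
  congr 1
  push_cast
  ring

lemma average_zet_zpow {N : ℕ} (hN : 0 < N) {m : ℤ} (hm : |m| < 2 * N) :
    (1 / (2 * (N : ℂ))) * ∑ j ∈ idxs N, zet N j ^ m = if m = 0 then 1 else 0 := by
  have hNc : (N : ℂ) ≠ 0 := by exact_mod_cast hN.ne'
  split_ifs with h
  · subst h
    rw [sum_idxs]
    simp
    field_simp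
  · have hw : zet N 1 ^ m ≠ 1 := by
      rw [zet, ← Complex.exp_int_mul, Ne, Complex.exp_eq_one_iff]
      rintro ⟨k, hk⟩
      have hpc : (Real.pi : ℂ) ≠ 0 := by exact_mod_cast Real.pi_ne_zero
      have hI := Complex.I_ne_zero
      have hk' : (m : ℂ) = 2 * N * k := by
        push_cast at hk
        field_simp at hk
        linear_combination hk
      have hk2 : m = 2 * N * k := by exact_mod_cast hk'
      have hk0 : k ≠ 0 := by rintro rfl; simp at hk2; exact h hk2
      have : 1 ≤ |k| := Int.one_le_abs hk0
      rw [hk2, abs_mul, abs_of_nonneg (by positivity : (0 : ℤ) ≤ 2 * N)] at hm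
      nlinarith
    have hw0 : zet N 1 ^ m ≠ 0 := zpow_ne_zero _ (zet_ne_zero _ _)
    have hw2 : (zet N 1 ^ m) ^ (2 * N) = 1 := by
      rw [zet, ← Complex.exp_int_mul, ← Complex.exp_nat_mul, Complex.exp_eq_one_iff]
      refine ⟨m, ?_⟩
      push_cast
      field_simp
    have hterm : ∀ i : ℕ, zet N (-(N : ℤ) + 1 + i) ^ m =
        (zet N 1 ^ m) ^ (-(N : ℤ) + 1) * (zet N 1 ^ m) ^ i := fun i => by
      rw [zet_zpow, zpow_add₀ hw0, zpow_natCast]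
    rw [sum_idxs, Finset.sum_congr rfl fun i _ => hterm i, ← Finset.mul_sum,
      geom_sum_eq hw, hw2]
    simp

lemma im_evalC {n : ℕ} (p : Coef n) {z : ℂ} (hz : ‖z‖ = 1) : (evalC p z).im = 0 := by
  have hinv : z⁻¹ = (starRingEnd ℂ) z := Complex.inv_eq_conj hz
  simp only [evalC, Complex.add_im, Complex.ofReal_im, Complex.im_sum, zero_add]
  refine Finset.sum_eq_zero fun k _ => ?_
  have : (starRingEnd ℂ) (p.2 k * z⁻¹ ^ ((k : ℕ) + 1)) =
      (starRingEnd ℂ) (p.2 k) * z ^ ((k : ℕ) + 1) := by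
    rw [hinv]; simp
  rw [← this, Complex.conj_im, add_neg_cancel]

lemma ofReal_evalR {n : ℕ} (p : Coef n) {z : ℂ} (hz : ‖z‖ = 1) :
    ((evalR p z : ℝ) : ℂ) = evalC p z :=
  Complex.ext (by simp [evalR]) (by simp [im_evalC p hz])

lemma evalR_eq {n : ℕ} (p : Coef n) {z : ℂ} (hz : ‖z‖ = 1) :
    evalR p z = p.1 + ∑ k : Fin n, 2 * (z ^ ((k : ℕ) + 1) * (starRingEnd ℂ) (p.2 k)).re := by
  have hinv : z⁻¹ = (starRingEnd ℂ) z := Complex.inv_eq_conj hz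
  simp only [evalR, evalC, Complex.add_re, Complex.ofReal_re, Complex.re_sum]
  congr 1
  refine Finset.sum_congr rfl fun k _ => ?_
  have : (starRingEnd ℂ) ((starRingEnd ℂ) (p.2 k) * z ^ ((k : ℕ) + 1)) =
      p.2 k * z⁻¹ ^ ((k : ℕ) + 1) := by
    rw [hinv]; simp
  rw [← this, Complex.conj_re, mul_comm (z ^ _)]
  ring

lemma evalR_sub {n : ℕ} (p q : Coef n) (z : ℂ) : evalR (p - q) z = evalR p z - evalR q z := by
  simp only [evalR, evalC, Prod.fst_sub, Prod.snd_sub, Pi.sub_apply, map_sub,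
    ← Complex.sub_re]
  congr 1
  push_cast
  rw [add_sub_add_comm, ← Finset.sum_sub_distrib]
  congr 1
  exact Finset.sum_congr rfl fun k _ => by ring

lemma norm_snd_apply_le {n : ℕ} (p : Coef n) (k : Fin n) : ‖p.2 k‖ ≤ ‖p‖ :=
  (norm_le_pi_norm p.2 k).trans (norm_snd_le p)

lemma abs_evalR_le {n : ℕ} (p : Coef n) {z : ℂ} (hz : ‖z‖ = 1) :
    |evalR p z| ≤ (2 * n + 1) * ‖p‖ := by
  rw [evalR_eq p hz]
  have h0 : |p.1| ≤ ‖p‖ := norm_fst_le p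
  have h1 : |∑ k : Fin n, 2 * (z ^ ((k : ℕ) + 1) * (starRingEnd ℂ) (p.2 k)).re| ≤
      ∑ _k : Fin n, 2 * ‖p‖ := by
    refine (Finset.abs_sum_le_sum_abs _ _).trans (Finset.sum_le_sum fun k _ => ?_)
    rw [abs_mul, abs_two]
    have := Complex.abs_re_le_norm (z ^ ((k : ℕ) + 1) * (starRingEnd ℂ) (p.2 k))
    rw [norm_mul, norm_pow, hz, one_pow, one_mul, RCLike.norm_conj] at this
    linarith [norm_snd_apply_le p k]
  rw [Finset.sum_const, Finset.card_univ, Fintype.card_fin, nsmul_eq_mul] at h1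
  refine (abs_add_le _ _).trans ?_
  linarith

lemma abs_pairCP_le {n : ℕ} (c p : Coef n) : |pairCP c p| ≤ (2 * n + 1) * (‖c‖ * ‖p‖) := by
  have h0 : |c.1 * p.1| ≤ ‖c‖ * ‖p‖ := by
    rw [abs_mul]
    exact mul_le_mul (norm_fst_le c) (norm_fst_le p) (abs_nonneg _) (norm_nonneg _)
  have h1 : |∑ k : Fin n, 2 * (c.2 k * (starRingEnd ℂ) (p.2 k)).re| ≤
      ∑ _k : Fin n, 2 * (‖c‖ * ‖p‖) := by
    refine (Finset.abs_sum_le_sum_abs _ _).trans (Finset.sum_le_sum fun k _ => ?_)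
    rw [abs_mul, abs_two]
    have := Complex.abs_re_le_norm (c.2 k * (starRingEnd ℂ) (p.2 k))
    rw [norm_mul, RCLike.norm_conj] at this
    have := mul_le_mul (norm_snd_apply_le c k) (norm_snd_apply_le p k) (norm_nonneg _) (norm_nonneg _)
    linarith
  rw [Finset.sum_const, Finset.card_univ, Fintype.card_fin, nsmul_eq_mul] at h1
  refine (abs_add_le _ _).trans ?_
  linarith

lemma pairCP_sub_left {n : ℕ} (c d p : Coef n) :
    pairCP (c - d) p = pairCP c p - pairCP d p := by
  simp only [pairCP, Prod.fst_sub, Prod.snd_sub, Pi.sub_apply, sub_mul, Complex.sub_re, mul_sub,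
    Finset.sum_sub_distrib]
  ring

lemma dmom_zero_re (N : ℕ) (Φ : ℤ → ℝ) :
    (dmom N Φ 0).re = 1 / (2 * (N : ℝ)) * ∑ j ∈ idxs N, Φ j := by
  have : dmom N Φ 0 = ((1 / (2 * (N : ℝ)) * ∑ j ∈ idxs N, Φ j : ℝ) : ℂ) := by
    simp [dmom]
  rw [this, Complex.ofReal_re]

/-- Pairing with the discrete moments of `Φ` is integration against `Φ` over the nodes. -/
lemma pairCP_dmom {n : ℕ} (N : ℕ) (Φ : ℤ → ℝ) (p : Coef n) :
    pairCP ((dmom N Φ 0).re, fun k : Fin n => dmom N Φ ((k : ℕ) + 1)) p =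
      1 / (2 * (N : ℝ)) * ∑ j ∈ idxs N, Φ j * evalR p (zet N j) := by
  have hk : ∀ k : Fin n, 2 * (dmom N Φ ((k : ℕ) + 1) * (starRingEnd ℂ) (p.2 k)).re =
      1 / (2 * (N : ℝ)) * ∑ j ∈ idxs N,
        Φ j * (2 * (zet N j ^ ((k : ℕ) + 1) * (starRingEnd ℂ) (p.2 k)).re) := by
    intro k
    have : dmom N Φ ((k : ℕ) + 1) * (starRingEnd ℂ) (p.2 k) =
        ((1 / (2 * (N : ℝ)) : ℝ) : ℂ) * ∑ j ∈ idxs N,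
          (Φ j : ℂ) * (zet N j ^ ((k : ℕ) + 1) * (starRingEnd ℂ) (p.2 k)) := by
      rw [dmom, mul_assoc, Finset.sum_mul]
      push_cast
      congr 1
      refine Finset.sum_congr rfl fun j _ => ?_
      rw [show ((k : ℕ) : ℤ) + 1 = (((k : ℕ) + 1 : ℕ) : ℤ) by push_cast; rfl, zpow_natCast]
      ring
    rw [this, Complex.re_ofReal_mul, Complex.re_sum, mul_left_comm, Finset.mul_sum]
    congr 1
    refine Finset.sum_congr rfl fun j _ => ?_
    rw [Complex.re_ofReal_mul]
    ring
  simp only [pairCP, hk, dmom_zero_re]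
  rw [← Finset.mul_sum, Finset.sum_comm, mul_assoc, ← mul_add, Finset.sum_mul,
    ← Finset.sum_add_distrib]
  congr 1
  refine Finset.sum_congr rfl fun j _ => ?_
  rw [evalR_eq p (norm_zet N j), mul_add, Finset.mul_sum]

lemma MomCond.eq {n N : ℕ} {c : Coef n} {Φ : ℤ → ℝ} (h : MomCond N c Φ) :
    c = ((dmom N Φ 0).re, fun k : Fin n => dmom N Φ ((k : ℕ) + 1)) := by
  refine Prod.ext ?_ (funext fun k => (h.2 k).symm)
  simp [h.1]

/-- A trigonometric polynomial is recovered from its values on the nodes. -/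
lemma dmom_evalR {n N : ℕ} (hN : n < N) (p : Coef n) {m : ℕ} (hm : m ≤ n) :
    dmom N (fun j => evalR p (zet N j)) m =
      if h : m = 0 then (p.1 : ℂ) else p.2 ⟨m - 1, by omega⟩ := by
  have hN0 : 0 < N := by omega
  have hexp : ∀ j, zet N j ^ (m : ℤ) * ((evalR p (zet N j) : ℝ) : ℂ) =
      p.1 * zet N j ^ (m : ℤ) + ∑ k : Fin n, (p.2 k * zet N j ^ ((m : ℤ) - ((k : ℕ) + 1)) +
        (starRingEnd ℂ) (p.2 k) * zet N j ^ ((m : ℤ) + ((k : ℕ) + 1))) := by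
    intro j
    have hz := zet_ne_zero N j
    rw [ofReal_evalR p (norm_zet N j), evalC, mul_add, Finset.mul_sum]
    congr 1
    · ring
    · refine Finset.sum_congr rfl fun k _ => ?_
      have h1 : zet N j ^ ((m : ℤ) - ((k : ℕ) + 1)) =
          zet N j ^ (m : ℤ) * (zet N j)⁻¹ ^ ((k : ℕ) + 1) := by
        rw [zpow_sub₀ hz, inv_pow, div_eq_mul_inv]; norm_cast
      have h2 : zet N j ^ ((m : ℤ) + ((k : ℕ) + 1)) =
          zet N j ^ (m : ℤ) * zet N j ^ ((k : ℕ) + 1) := by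
        rw [zpow_add₀ hz]; norm_cast
      rw [h1, h2]
      ring
  have hav : ∀ a : ℤ, |a| < 2 * N → ∀ b : ℂ,
      (1 / (2 * (N : ℂ))) * ∑ j ∈ idxs N, b * zet N j ^ a = if a = 0 then b else 0 := by
    intro a ha b
    rw [← Finset.mul_sum, mul_left_comm, average_zet_zpow hN0 ha]
    split_ifs <;> simp
  have hk1 : ∀ k : Fin n, (1 / (2 * (N : ℂ))) * ∑ j ∈ idxs N,
      p.2 k * zet N j ^ ((m : ℤ) - ((k : ℕ) + 1)) = if m = (k : ℕ) + 1 then p.2 k else 0 := by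
    intro k
    have := k.2
    rw [hav _ (by rw [abs_lt]; omega)]
    exact if_congr (by omega) rfl rfl
  have hk2 : ∀ k : Fin n, (1 / (2 * (N : ℂ))) * ∑ j ∈ idxs N,
      (starRingEnd ℂ) (p.2 k) * zet N j ^ ((m : ℤ) + ((k : ℕ) + 1)) = 0 := by
    intro k
    have := k.2
    rw [hav _ (by rw [abs_lt]; omega), if_neg (by omega)]
  rw [dmom, Finset.sum_congr rfl fun j _ => hexp j, Finset.sum_add_distrib, mul_add,
    hav _ (by rw [abs_lt]; omega), Finset.sum_comm, Finset.mul_sum]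
  simp only [Finset.sum_add_distrib, mul_add, hk1, hk2, add_zero]
  split_ifs with h h' h'
  · simp [h']
  · omega
  · omega
  · rw [zero_add, Finset.sum_eq_single ⟨m - 1, by omega⟩]
    · rw [if_pos (by dsimp only; omega)]
    · intro k _ hk
      rw [if_neg]
      rintro rfl
      exact hk (Fin.ext (by simp))
    · simp

lemma norm_le_average_abs {n N : ℕ} (hN : n < N) (p : Coef n) :
    ‖p‖ ≤ 1 / (2 * (N : ℝ)) * ∑ j ∈ idxs N, |evalR p (zet N j)| := by
  have key : ∀ m : ℕ, ‖dmom N (fun j => evalR p (zet N j)) m‖ ≤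
      1 / (2 * (N : ℝ)) * ∑ j ∈ idxs N, |evalR p (zet N j)| := by
    intro m
    rw [dmom, norm_mul]
    have : ‖(1 / (2 * (N : ℂ)))‖ = 1 / (2 * (N : ℝ)) := by simp
    rw [this]
    gcongr
    refine (norm_sum_le _ _).trans (Finset.sum_le_sum fun j _ => ?_)
    rw [norm_mul, norm_zpow, norm_zet, one_zpow, one_mul, Complex.norm_real, Real.norm_eq_abs]
  refine norm_prod_le_iff.2 ⟨?_, (pi_norm_le_iff_of_nonneg ((norm_nonneg _).trans (key 0))).2
    fun k => ?_⟩
  · have := key 0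
    rw [dmom_evalR hN p (Nat.zero_le n)] at this
    simpa using this
  · have := key ((k : ℕ) + 1)
    rw [dmom_evalR hN p k.2] at this
    simpa using this

lemma sq_norm_le_average_sq {n N : ℕ} (hN : n < N) (p : Coef n) :
    ‖p‖ ^ 2 ≤ 1 / (2 * (N : ℝ)) * ∑ j ∈ idxs N, evalR p (zet N j) ^ 2 := by
  have hN0 : (0 : ℝ) < N := by
    have : 0 < N := by omega
    exact_mod_cast this
  have hcard : ((idxs N).card : ℝ) = 2 * N := by
    have : (idxs N).card = 2 * N := by
      rw [idxs, Int.card_Icc]; omega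
    rw [this]; push_cast; rfl
  have h := sq_sum_le_card_mul_sum_sq (s := idxs N) (f := fun j => |evalR p (zet N j)|)
  simp only [sq_abs, hcard] at h
  calc ‖p‖ ^ 2 ≤ (1 / (2 * (N : ℝ)) * ∑ j ∈ idxs N, |evalR p (zet N j)|) ^ 2 := by
        gcongr; exact norm_le_average_abs hN p
    _ = (1 / (2 * (N : ℝ))) ^ 2 * (∑ j ∈ idxs N, |evalR p (zet N j)|) ^ 2 := by ring
    _ ≤ (1 / (2 * (N : ℝ))) ^ 2 * (2 * N * ∑ j ∈ idxs N, evalR p (zet N j) ^ 2) := by gcongr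
    _ = _ := by field_simp

lemma continuous_evalR_exp {n : ℕ} (p : Coef n) :
    Continuous fun θ : ℝ => evalR p (Complex.exp (θ * Complex.I)) := by
  have : (fun θ : ℝ => evalR p (Complex.exp (θ * Complex.I))) = fun θ : ℝ =>
      p.1 + ∑ k : Fin n, 2 * (Complex.exp (θ * Complex.I) ^ ((k : ℕ) + 1) *
        (starRingEnd ℂ) (p.2 k)).re :=
    funext fun θ => evalR_eq p (Complex.norm_exp_ofReal_mul_I θ)
  rw [this]
  fun_prop

lemma continuousOn_ratio {n : ℕ} (P : Coef n) {Q : Coef n} (hQ : Q ∈ PplusC n) :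
    ContinuousOn (fun θ : ℝ => evalR P (Complex.exp (θ * Complex.I)) /
      evalR Q (Complex.exp (θ * Complex.I))) (Set.Icc (-Real.pi) Real.pi) :=
  (continuous_evalR_exp P).continuousOn.div (continuous_evalR_exp Q).continuousOn
    fun θ hθ => (hQ θ hθ).ne'

lemma tendsto_dmom {n : ℕ} (P : Coef n) {Q : Coef n} (hQ : Q ∈ PplusC n) (k : ℤ) :
    Tendsto (fun N => dmom N (phiOf N P Q) k) atTop (𝓝 (cmom P Q k)) := by
  have hcont : ContinuousOn (fun θ : ℝ => Complex.exp (Complex.I * (k : ℂ) * (θ : ℂ)) *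
      ((evalR P (Complex.exp (θ * Complex.I)) / evalR Q (Complex.exp (θ * Complex.I)) : ℝ) : ℂ))
      (Set.Icc (-Real.pi) Real.pi) :=
    ContinuousOn.mul (by fun_prop)
      (Complex.continuous_ofReal.comp_continuousOn (continuousOn_ratio P hQ))
  refine (tendsto_average_idxs hcont).congr fun N => ?_
  rw [dmom]
  congr 1
  refine Finset.sum_congr rfl fun j _ => ?_
  rw [phiOf, zet_eq, ← Complex.exp_int_mul]
  congr 2
  ring

lemma tendsto_Fmap {n : ℕ} {c P Q : Coef n} (hQ : Q ∈ PplusC n) (h : CMomCond c P Q) :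
    Tendsto (fun N => Fmap N P Q) atTop (𝓝 c) := by
  refine Tendsto.prodMk_nhds (x := c.1) (y := c.2) ?_ (tendsto_pi_nhds.2 fun k => ?_)
  · have := (Complex.continuous_re.tendsto _).comp (tendsto_dmom P hQ 0)
    rwa [h.1, Complex.ofReal_re] at this
  · rw [← h.2 k]
    exact tendsto_dmom P hQ _

lemma exists_ratio_lower_bound {n : ℕ} {P Q : Coef n} (hP : P ∈ PplusC n) (hQ : Q ∈ PplusC n) :
    ∃ μ > 0, ∀ N, ∀ j ∈ idxs N, μ ≤ phiOf N P Q j := by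
  obtain ⟨θ, hθ, hmin⟩ := isCompact_Icc.exists_isMinOn
    (Set.nonempty_Icc.2 (by linarith [Real.pi_pos])) (continuousOn_ratio P hQ)
  refine ⟨_, div_pos (hP θ hθ) (hQ θ hθ), fun N j hj => ?_⟩
  rw [phiOf, zet_eq]
  exact hmin (node_mem hj)

lemma mem_Cplus_of_norm_lt {n N : ℕ} (hN : n < N) {c P Q : Coef n} {μ : ℝ}
    (hμ : 0 < μ) (hμP : ∀ j ∈ idxs N, μ ≤ phiOf N P Q j)
    (hε : (2 * n + 1) * ‖c - Fmap N P Q‖ < μ) : c ∈ Cplus n N := by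
  intro p hp hp0
  have h1 : μ * ‖p‖ ≤ pairCP (Fmap N P Q) p := by
    rw [Fmap, pairCP_dmom]
    calc μ * ‖p‖ ≤ μ * (1 / (2 * (N : ℝ)) * ∑ j ∈ idxs N, |evalR p (zet N j)|) := by
          gcongr; exact norm_le_average_abs hN p
      _ = 1 / (2 * (N : ℝ)) * ∑ j ∈ idxs N, μ * evalR p (zet N j) := by
          rw [mul_left_comm, Finset.mul_sum]
          congr 1
          exact Finset.sum_congr rfl fun j hj => by rw [abs_of_nonneg (hp j hj)]
      _ ≤ _ := by
          gcongr with j hj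
          · exact hp j hj
          · exact hμP j hj
  have h2 := abs_le.1 (abs_pairCP_le (c - Fmap N P Q) p)
  rw [pairCP_sub_left] at h2
  have h3 : 0 < ‖p‖ := norm_pos_iff.2 hp0
  nlinarith [h2.1]

/-- Monotonicity of `Q ↦ -P / Q` bounds the distance between two solutions by the
distance between their moments. -/
lemma norm_sub_le_of_momCond {n N : ℕ} (hN : n < N) {c P Q R : Coef n} {μ : ℝ}
    (hμ : 0 < μ) (hQ : Q ∈ Pplus n N) (hR : R ∈ Pplus n N)
    (hμP : ∀ j ∈ idxs N, μ ≤ phiOf N P Q j) (h : MomCond N c (phiOf N P R)) :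
    μ * ‖R - Q‖ ≤ (2 * n + 1) ^ 2 * ‖c - Fmap N P Q‖ * ‖R‖ := by
  set d := R - Q with hd
  have hdz : ∀ j, evalR d (zet N j) = evalR R (zet N j) - evalR Q (zet N j) :=
    fun j => evalR_sub R Q _
  rcases (norm_nonneg d).eq_or_lt with h0 | hpos
  · rw [← h0, mul_zero]; positivity
  have hbound := neg_le_of_abs_le (abs_pairCP_le (c - Fmap N P Q) d)
  rw [pairCP_sub_left] at hbound
  have hsq := sq_norm_le_average_sq hN d
  have hpoint : ∀ j ∈ idxs N, μ * evalR d (zet N j) ^ 2 ≤ (2 * n + 1) * ‖R‖ *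
      (phiOf N P Q j * evalR d (zet N j) - phiOf N P R j * evalR d (zet N j)) := by
    intro j hj
    have hq := hQ j hj
    have hr := hR j hj
    have hrb := (le_abs_self _).trans (abs_evalR_le R (norm_zet N j))
    have hμ' := hμP j hj
    have hid : phiOf N P Q j * evalR d (zet N j) ^ 2 = evalR R (zet N j) *
        (phiOf N P Q j * evalR d (zet N j) - phiOf N P R j * evalR d (zet N j)) := by
      simp only [phiOf, hdz]
      field_simp
    have hx : 0 ≤ phiOf N P Q j * evalR d (zet N j) - phiOf N P R j * evalR d (zet N j) := by
      refine nonneg_of_mul_nonneg_right ?_ hr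
      rw [← hid]
      exact mul_nonneg (hμ.le.trans hμ') (sq_nonneg _)
    calc μ * evalR d (zet N j) ^ 2 ≤ phiOf N P Q j * evalR d (zet N j) ^ 2 := by gcongr
      _ ≤ _ := by rw [hid]; gcongr
  have hchain : μ * ‖d‖ ^ 2 ≤
      (2 * n + 1) * ‖R‖ * ((2 * n + 1) * (‖c - Fmap N P Q‖ * ‖d‖)) := by
    calc μ * ‖d‖ ^ 2 ≤ μ * (1 / (2 * (N : ℝ)) * ∑ j ∈ idxs N, evalR d (zet N j) ^ 2) := by
          gcongr
      _ = 1 / (2 * (N : ℝ)) * ∑ j ∈ idxs N, μ * evalR d (zet N j) ^ 2 := by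
          rw [mul_left_comm, Finset.mul_sum]
      _ ≤ 1 / (2 * (N : ℝ)) * ∑ j ∈ idxs N, (2 * n + 1) * ‖R‖ *
          (phiOf N P Q j * evalR d (zet N j) - phiOf N P R j * evalR d (zet N j)) := by
          exact mul_le_mul_of_nonneg_left (Finset.sum_le_sum hpoint) (by positivity)
      _ = (2 * n + 1) * ‖R‖ *
          (pairCP (Fmap N P Q) d - pairCP c d) := by
          rw [h.eq, Fmap, pairCP_dmom, pairCP_dmom, ← Finset.mul_sum, Finset.sum_sub_distrib]
          ring
      _ ≤ _ := by gcongr; linarith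
  refine le_of_mul_le_mul_right ?_ hpos
  linarith

/-- **Theorem 6.** The solutions `Q_N` of the circulant (discrete) rational
covariance extension problems converge, as `N → ∞`, to the solution `Q` of the ordinary
(continuous) rational covariance extension problem. -/
theorem discrete_solutions_converge_to_continuous
    (n : ℕ) (hn : 1 ≤ n) (c P Q : Coef n)
    (hc : c ∈ CplusC n) (hP : P ∈ PplusC n) (hQ : Q ∈ PplusC n)
    (hQm : CMomCond c P Q)
    (hQuniq : ∀ Q' ∈ PplusC n, CMomCond c P Q' → Q' = Q)
    (Qf : ℕ → Coef n)
    (hQf : ∀ N : ℕ, n < N → c ∈ Cplus n N →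
      Qf N ∈ Pplus n N ∧ MomCond N c (phiOf N P (Qf N))) :
    Filter.Tendsto Qf Filter.atTop (nhds Q) := by
  obtain ⟨μ, hμ, hμP⟩ := exists_ratio_lower_bound hP hQ
  have hF : Tendsto (fun N => ‖c - Fmap N P Q‖) atTop (𝓝 0) := by
    simpa using (tendsto_const_nhds.sub (tendsto_Fmap hQ hQm)).norm (a := c - c)
  have hF1 := hF.const_mul (2 * n + 1 : ℝ)
  have hF2 := hF.const_mul ((2 * n + 1 : ℝ) ^ 2)
  rw [mul_zero] at hF1 hF2
  rw [tendsto_iff_norm_sub_tendsto_zero]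
  have hlim := (hF2.mul_const ‖Q‖).const_mul (2 / μ)
  rw [zero_mul, mul_zero] at hlim
  refine squeeze_zero' (Eventually.of_forall fun N => norm_nonneg _) ?_ hlim
  filter_upwards [hF1.eventually_lt_const hμ, hF2.eventually_lt_const (half_pos hμ),
    eventually_gt_atTop n] with N h1 h2 hN
  obtain ⟨hpos, hmom⟩ := hQf N hN (mem_Cplus_of_norm_lt hN hμ (hμP N) h1)
  have hQN : Q ∈ Pplus n N := fun j hj => by
    rw [zet_eq]
    exact hQ _ (node_mem hj)
  have hle := norm_sub_le_of_momCond hN hμ hQN hpos (hμP N) hmom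
  have htri : ‖Qf N‖ ≤ ‖Qf N - Q‖ + ‖Q‖ := by
    simpa using norm_add_le (Qf N - Q) Q
  set e := (2 * n + 1 : ℝ) ^ 2 * ‖c - Fmap N P Q‖
  have he : 0 ≤ e := by positivity
  rw [div_mul_eq_mul_div, le_div_iff₀ hμ]
  nlinarith [mul_le_mul_of_nonneg_left htri he,
    mul_le_mul_of_nonneg_right h2.le (norm_nonneg (Qf N - Q))]
end
end
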